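/- Let E be a generalized Banach space, S a nonempty closed convex subset of E, and μ a monotone, regular, real, lower-additive generalized measure of noncompactness on E. Let F and G be multivalued mappings on S with closed graphs whose values F(x) and G(x) are nonempty closed convex subsets of E. Assume: (i) there exists a continuous nondecreasing function φ : [0,∞)ⁿ → [0,∞)ⁿ (componentwise order) with φᵐ(t) → 0 as m → ∞ for every t ∈ [0,∞)ⁿ, such that μ(F(V)) ≤ φ(μ(V)) componentwise for every bounded subset V of S; (ii) G(S) is relatively compact; (iii) F(x) + G(x) ⊆ S for every x ∈ S and the set ⋃_{x∈S}(F(x)+G(x)) is bounded. Then there exists x ∈ S with x ∈ F(x) + G(x). -/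

import Mathlib

open Filter Topology Set Bornology Pointwise
open scoped NNReal ENNReal

/-- A multivalued map `Q` on `S` has a closed graph: whenever `xₘ ∈ S`, `xₘ → a ∈ S`,
`yₘ ∈ Q xₘ` and `yₘ → b`, then `b ∈ Q a`. -/
def HasClosedGraphMV {E : Type*} [TopologicalSpace E] (S : Set E) (Q : E → Set E) : Prop :=
  ∀ (x y : ℕ → E) (a b : E), (∀ m, x m ∈ S) → a ∈ S →
    Tendsto x atTop (nhds a) → (∀ m, y m ∈ Q (x m)) → Tendsto y atTop (nhds b) → b ∈ Q a

/-- No point of `X` is strictly above `σ` with respect to every index `i`. -/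
def IsDominant {I X α : Type*} [LE α] (u : I → X → α) (σ : Finset X) : Prop :=
  ∀ y, ∃ i, ∀ x ∈ σ, u i y ≤ u i x

section Scarf

variable {I X α : Type*} [Fintype I] [DecidableEq I] [DecidableEq X]

/-- A set with as many elements as there are colours, not carrying all colours, has an even number
of facets carrying exactly the colours other than `i₀`. -/
lemma even_card_filter_image_erase (c : X → I) (i₀ : I) (σ : Finset X)
    (hσ : σ.card = Fintype.card I) (hc : σ.image c ≠ Finset.univ) :
    Even (σ.filter fun x => (σ.erase x).image c = {i₀}ᶜ).card := by
  rcases Finset.eq_empty_or_nonempty (σ.filter fun x => (σ.erase x).image c = {i₀}ᶜ) with h | ⟨x, hx⟩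
  · simp [h]
  rw [Finset.mem_filter] at hx
  obtain ⟨hxσ, hx⟩ := hx
  have hcx : c x ∈ (σ.erase x).image c := by
    rw [hx]
    simp only [Finset.mem_compl, Finset.mem_singleton]
    intro h
    apply hc
    rw [← Finset.insert_erase hxσ, Finset.image_insert, hx, h]
    ext; simp
  obtain ⟨x', hx', hcc⟩ := Finset.mem_image.1 hcx
  obtain ⟨hne, hx'σ⟩ := Finset.mem_erase.1 hx'
  have hI : ({i₀}ᶜ : Finset I).card + 1 = Fintype.card I := by
    rw [Finset.card_compl, Finset.card_singleton]
    have : 0 < Fintype.card I := Fintype.card_pos_iff.2 ⟨i₀⟩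
    omega
  have key : (σ.filter fun x => (σ.erase x).image c = {i₀}ᶜ) = {x, x'} := by
    ext z
    simp only [Finset.mem_filter, Finset.mem_insert, Finset.mem_singleton]
    constructor
    · rintro ⟨hz, hzi⟩
      by_contra! hcon
      have hinj : Set.InjOn c (σ.erase z) := by
        rw [← Finset.card_image_iff, hzi, Finset.card_erase_of_mem hz]
        omega
      exact hne (hinj (by simp [hx'σ, hcon.2.symm]) (by simp [hxσ, hcon.1.symm]) hcc)
    · rintro (rfl | rfl)
      · exact ⟨hxσ, hx⟩
      · refine ⟨hx'σ, ?_⟩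
        rw [← hx]
        ext k
        simp only [Finset.mem_image, Finset.mem_erase]
        constructor
        · rintro ⟨a, ⟨h1, h2⟩, rfl⟩
          by_cases hax : a = x
          · exact ⟨z, ⟨hne, hx'σ⟩, by rw [hax, hcc]⟩
          · exact ⟨a, ⟨hax, h2⟩, rfl⟩
        · rintro ⟨a, ⟨h1, h2⟩, rfl⟩
          by_cases hax : a = z
          · exact ⟨x, ⟨hne.symm, hxσ⟩, by rw [hax, hcc]⟩
          · exact ⟨a, ⟨hax, h2⟩, rfl⟩
  rw [key, Finset.card_pair hne.symm]
  exact even_two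

variable [Fintype X] [LinearOrder α]

/-- If every index `k` admits a point strictly above `τ` in all indices other than `k`, then `τ`
extends to a dominant set of full size in an even number of ways. -/
lemma even_card_dominant_insert (u : I → X → α) (hu : ∀ i, Function.Injective (u i))
    (τ : Finset X) (hτ : τ.card + 1 = Fintype.card I) (hτn : τ.Nonempty)
    (habove : ∀ k, ∃ y, ∀ l, l ≠ k → ∃ z ∈ τ, u l z < u l y)
    [DecidablePred fun x => x ∉ τ ∧ IsDominant u (insert x τ)] :
    Even (Finset.univ.filter fun x => x ∉ τ ∧ IsDominant u (insert x τ)).card := by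
  rcases Finset.eq_empty_or_nonempty
    (Finset.univ.filter fun x => x ∉ τ ∧ IsDominant u (insert x τ)) with h | ⟨x₀, hx₀⟩
  · simp [h]
  simp only [Finset.mem_filter, Finset.mem_univ, true_and] at hx₀
  have hD : IsDominant u τ := fun y =>
    (hx₀.2 y).imp fun i hi x hx => hi x (Finset.mem_insert_of_mem hx)
  choose p hpτ hp using fun k => Finset.exists_min_image τ (u k) hτn
  have hpmin : ∀ k z, z ∈ τ → (∀ w ∈ τ, u k z ≤ u k w) → z = p k := fun k z hz h =>
    hu k (le_antisymm (h _ (hpτ k)) (hp k z hz))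
  have hlow : ∀ x, x ∉ τ → IsDominant u (insert x τ) →
      ∃ k, u k x < u k (p k) ∧ (∀ l, l ≠ k → u l (p l) < u l x) ∧ Set.InjOn p {k}ᶜ := by
    intro x hx hDx
    obtain ⟨k, hk⟩ := hDx x
    have hkx : u k x < u k (p k) :=
      lt_of_le_of_ne (hk _ (Finset.mem_insert_of_mem (hpτ k)))
        fun h => hx (hu k h ▸ hpτ k)
    set K : Finset I := Finset.univ.filter fun l => u l (p l) < u l x with hK
    have hsurj : τ ⊆ K.image p := by
      intro y hy
      obtain ⟨l, hl⟩ := hDx y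
      have hyl := hpmin l y hy fun w hw => hl w (Finset.mem_insert_of_mem hw)
      refine Finset.mem_image.2 ⟨l, ?_, hyl.symm⟩
      simp only [hK, Finset.mem_filter, Finset.mem_univ, true_and]
      rw [← hyl]
      exact lt_of_le_of_ne (hl x (Finset.mem_insert_self _ _)) fun h => hx (hu l h ▸ hy)
    have hKk : K ⊆ {k}ᶜ := by
      intro l hl
      simp only [Finset.mem_compl, Finset.mem_singleton]
      rintro rfl
      exact lt_asymm hkx (Finset.mem_filter.1 hl).2
    have hkc : ({k}ᶜ : Finset I).card = τ.card := by
      rw [Finset.card_compl, Finset.card_singleton]; omega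
    have h1 := Finset.card_le_card hsurj
    have h2 := Finset.card_image_le (s := K) (f := p)
    have hKeq : K = {k}ᶜ := Finset.eq_of_subset_of_card_le hKk (by omega)
    refine ⟨k, hkx, fun l hl => ?_, ?_⟩
    · have : l ∈ K := by rw [hKeq]; simpa using hl
      exact (Finset.mem_filter.1 this).2
    · have h3 := Finset.card_le_card hKk
      have : Set.InjOn p K := Finset.card_image_iff.1 (by omega)
      rw [hKeq] at this
      simpa using this
  have hsurjp : ∀ y ∈ τ, ∃ k, p k = y := fun y hy =>
    (hD y).imp fun k hk => (hpmin k y hy hk).symm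
  obtain ⟨i, j, hij, hpij⟩ : ∃ i j, i ≠ j ∧ p i = p j := by
    have hlt : τ.card < (Finset.univ : Finset I).card := by rw [Finset.card_univ]; omega
    obtain ⟨i, -, j, -, h⟩ := Finset.exists_ne_map_eq_of_card_lt_of_maps_to hlt
      (f := p) (fun k _ => hpτ k)
    exact ⟨i, j, h⟩
  have hexists : ∀ k k', k ≠ k' → p k = p k' → ∃ x, x ∉ τ ∧ IsDominant u (insert x τ) ∧
      u k x < u k (p k) ∧ ∀ y, (∀ l, l ≠ k → u l (p l) < u l y) → u k y ≤ u k x := by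
    intro k k' hkk hpk
    have hne : (Finset.univ.filter fun y => ∀ l, l ≠ k → u l (p l) < u l y).Nonempty := by
      obtain ⟨y, hy⟩ := habove k
      refine ⟨y, Finset.mem_filter.2 ⟨Finset.mem_univ _, fun l hl => ?_⟩⟩
      obtain ⟨z, hz, hzy⟩ := hy l hl
      exact (hp l z hz).trans_lt hzy
    obtain ⟨x, hxM, hmax⟩ := Finset.exists_max_image _ (u k) hne
    simp only [Finset.mem_filter, Finset.mem_univ, true_and] at hxM hmax
    have hxτ : x ∉ τ := by
      intro hx
      obtain ⟨l, rfl⟩ := hsurjp x hx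
      by_cases hl : l = k
      · subst hl
        have := hxM k' hkk.symm
        rw [hpk] at this
        exact lt_irrefl _ this
      · exact lt_irrefl _ (hxM l hl)
    have hlowM : ∀ y, (∀ l, l ≠ k → u l (p l) < u l y) → u k y ≤ u k (p k) := by
      intro y hy
      obtain ⟨l, hl⟩ := hD y
      by_cases hlk : l = k
      · subst hlk; exact hl _ (hpτ _)
      · exact absurd (hl _ (hpτ l)) (hy l hlk).not_ge
    refine ⟨x, hxτ, fun y => ?_, lt_of_le_of_ne (hlowM x hxM) fun h => hxτ (hu k h ▸ hpτ k), hmax⟩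
    by_contra! hcon
    have hyM : ∀ l, l ≠ k → u l (p l) < u l y := by
      intro l hl
      obtain ⟨z, hz, hzy⟩ := hcon l
      rcases Finset.mem_insert.1 hz with rfl | hz
      · exact (hxM l hl).trans hzy
      · exact (hp l z hz).trans_lt hzy
    obtain ⟨z, hz, hzy⟩ := hcon k
    rcases Finset.mem_insert.1 hz with rfl | hz
    · exact (hmax y hyM).not_gt hzy
    · exact ((hlowM y hyM).trans (hp k z hz)).not_gt hzy
  have hunique : ∀ k x x', (x ∉ τ ∧ IsDominant u (insert x τ) ∧ u k x < u k (p k)) →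
      (∀ y, (∀ l, l ≠ k → u l (p l) < u l y) → u k y ≤ u k x') →
      (∀ l, l ≠ k → u l (p l) < u l x') → x = x' := by
    rintro k x x' ⟨hx, hDx, hkx⟩ hmax hxM'
    obtain ⟨k', -, hk', -⟩ := hlow x hx hDx
    obtain rfl : k = k' := by
      by_contra h
      exact lt_asymm hkx (hk' k h)
    refine hu k (le_antisymm (hmax x hk') ?_)
    obtain ⟨l, hl⟩ := hDx x'
    by_cases hlk : l = k
    · subst hlk; exact hl _ (Finset.mem_insert_self _ _)
    · exact absurd (hl _ (Finset.mem_insert_of_mem (hpτ l))) (hxM' l hlk).not_ge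
  have hother : ∀ k x, x ∉ τ → IsDominant u (insert x τ) → u k x < u k (p k) →
      ∀ l, l ≠ k → u l (p l) < u l x := by
    intro k x hx hDx hkx
    obtain ⟨k', -, hk', -⟩ := hlow x hx hDx
    obtain rfl : k = k' := by
      by_contra h
      exact lt_asymm hkx (hk' k h)
    exact hk'
  obtain ⟨a, ha, hDa, hia, hmaxa⟩ := hexists i j hij hpij
  obtain ⟨b, hb, hDb, hjb, hmaxb⟩ := hexists j i hij.symm hpij.symm
  have hab : a ≠ b := by
    rintro rfl
    exact lt_asymm hia (hother j a hb hDb hjb i hij)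
  have key : (Finset.univ.filter fun x => x ∉ τ ∧ IsDominant u (insert x τ)) = {a, b} := by
    ext x
    simp only [Finset.mem_filter, Finset.mem_univ, true_and, Finset.mem_insert,
      Finset.mem_singleton]
    constructor
    · rintro ⟨hx, hDx⟩
      obtain ⟨k, hk, -, hinj⟩ := hlow x hx hDx
      by_cases hki : i = k
      · subst hki
        exact Or.inl (hunique i x a ⟨hx, hDx, hk⟩ hmaxa (hother i a ha hDa hia))
      by_cases hkj : j = k
      · subst hkj
        exact Or.inr (hunique j x b ⟨hx, hDx, hk⟩ hmaxb (hother j b hb hDb hjb))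
      exact absurd (hinj (by simpa using hki) (by simpa using hkj) hpij) hij
    · rintro (rfl | rfl)
      · exact ⟨ha, hDa⟩
      · exact ⟨hb, hDb⟩
  rw [key, Finset.card_pair hab]
  exact even_two

/-- The facet of all slack points except the one of index `i₀` extends to exactly one dominant set
of full size. -/
lemma card_dominant_insert_slack (u : I → X → α) (hu : ∀ i, Function.Injective (u i))
    (e : I → X) (hlow : ∀ i x, x ≠ e i → u i (e i) < u i x)
    (hhigh : ∀ i j x, x ∉ Set.range e → j ≠ i → u i x < u i (e j)) (he : Function.Injective e)
    (i₀ : I) [DecidablePred fun x => x ∉ ({i₀}ᶜ : Finset I).image e ∧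
      IsDominant u (insert x (({i₀}ᶜ : Finset I).image e))] :
    (Finset.univ.filter fun x => x ∉ ({i₀}ᶜ : Finset I).image e ∧
      IsDominant u (insert x (({i₀}ᶜ : Finset I).image e))).card = 1 := by
  set τ := ({i₀}ᶜ : Finset I).image e with hτ
  have hmem : ∀ x, x ∈ τ ↔ ∃ j, j ≠ i₀ ∧ e j = x := by intro x; simp [hτ]
  have hne : (Finset.univ.filter fun x => x ∉ τ).Nonempty := by
    refine ⟨e i₀, Finset.mem_filter.2 ⟨Finset.mem_univ _, fun h => ?_⟩⟩
    obtain ⟨j, hj, hej⟩ := (hmem _).1 h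
    exact hj (he hej)
  obtain ⟨a, ha, hmax⟩ := Finset.exists_max_image _ (u i₀) hne
  simp only [Finset.mem_filter, Finset.mem_univ, true_and] at ha hmax
  rw [Finset.card_eq_one]
  refine ⟨a, ?_⟩
  ext x
  simp only [Finset.mem_filter, Finset.mem_univ, true_and, Finset.mem_singleton]
  constructor
  · rintro ⟨hx, hDx⟩
    obtain ⟨l, hl⟩ := hDx a
    by_cases hl0 : l = i₀
    · subst hl0
      exact hu l (le_antisymm (hmax x hx) (hl x (Finset.mem_insert_self _ _)))
    · have hel : e l ∈ τ := (hmem _).2 ⟨l, hl0, rfl⟩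
      have := hl _ (Finset.mem_insert_of_mem hel)
      exact absurd this (hlow l a fun h => ha (h ▸ hel)).not_ge
  · rintro rfl
    refine ⟨ha, fun y => ?_⟩
    by_cases hy : y ∈ τ
    · obtain ⟨j, -, rfl⟩ := (hmem y).1 hy
      refine ⟨j, fun z _ => ?_⟩
      by_cases hz : z = e j
      · rw [hz]
      · exact (hlow j z hz).le
    · refine ⟨i₀, fun z hz => ?_⟩
      rcases Finset.mem_insert.1 hz with rfl | hz
      · exact hmax y hy
      obtain ⟨j, hj, rfl⟩ := (hmem z).1 hz
      by_cases hyr : y ∈ Set.range e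
      · obtain ⟨k, rfl⟩ := hyr
        obtain rfl : k = i₀ := by
          by_contra hk
          exact hy ((hmem _).2 ⟨k, hk, rfl⟩)
        exact (hlow k _ fun h => hj (he h)).le
      · exact (hhigh i₀ j y hyr hj).le

/-- **Scarf's lemma**: among points ordered in `|I|` ways and coloured by `I`, together with one
slack point of each colour, some dominant set of size `|I|` carries every colour. -/
theorem exists_dominant_image_eq_univ [Nonempty I] (u : I → X → α)
    (hu : ∀ i, Function.Injective (u i)) (e : I → X)
    (hlow : ∀ i x, x ≠ e i → u i (e i) < u i x)
    (hhigh : ∀ i j x, x ∉ Set.range e → j ≠ i → u i x < u i (e j))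
    (c : X → I) (hce : ∀ i, c (e i) = i) :
    ∃ σ : Finset X, IsDominant u σ ∧ σ.card = Fintype.card I ∧ σ.image c = Finset.univ := by
  classical
  obtain ⟨i₀⟩ := ‹Nonempty I›
  have he : Function.Injective e := fun a b h => by rw [← hce a, h, hce]
  by_contra! hcon
  set R : Finset (Finset X) :=
    Finset.univ.filter fun σ => IsDominant u σ ∧ σ.card = Fintype.card I with hR
  set T : Finset (Finset X) :=
    Finset.univ.filter fun τ => τ.card + 1 = Fintype.card I ∧ τ.image c = {i₀}ᶜ with hT
  have hcount := Finset.sum_card_bipartiteAbove_eq_sum_card_bipartiteBelow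
    (s := T) (t := R) (fun τ σ => τ ⊆ σ)
  have hright : Even (∑ σ ∈ R, (T.bipartiteBelow (fun τ σ => τ ⊆ σ) σ).card) := by
    refine Finset.even_sum _ fun σ hσ => ?_
    obtain ⟨-, hD, hcard⟩ := Finset.mem_filter.1 hσ
    refine (congrArg Even ?_).mp (even_card_filter_image_erase c i₀ σ hcard (hcon σ hD hcard))
    refine Finset.card_bij (fun x _ => σ.erase x) ?_ ?_ ?_
    · intro x hx
      obtain ⟨hxσ, hx⟩ := Finset.mem_filter.1 hx
      simp only [Finset.bipartiteBelow, hT, Finset.mem_filter, Finset.mem_univ, true_and]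
      exact ⟨⟨by rw [Finset.card_erase_add_one hxσ, hcard], hx⟩, Finset.erase_subset _ _⟩
    · intro x hx y hy h
      exact Finset.erase_injOn σ (Finset.mem_filter.1 hx).1 (Finset.mem_filter.1 hy).1 h
    · intro τ hτ
      simp only [Finset.bipartiteBelow, hT, Finset.mem_filter, Finset.mem_univ, true_and] at hτ
      obtain ⟨⟨h1, h2⟩, h3⟩ := hτ
      obtain ⟨x, hx, rfl⟩ := (Finset.covBy_iff_exists_insert.1
        (Finset.covBy_iff_card_sdiff_eq_one.2 ⟨h3, by
          rw [Finset.card_sdiff_of_subset h3]; omega⟩))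
      exact ⟨x, by simp [Finset.erase_insert hx, h2], Finset.erase_insert hx⟩
  have hdeg : ∀ τ ∈ T, (R.bipartiteAbove (fun τ σ => τ ⊆ σ) τ).card =
      (Finset.univ.filter fun x => x ∉ τ ∧ IsDominant u (insert x τ)).card := by
    intro τ hτ
    obtain ⟨-, hcard, -⟩ := Finset.mem_filter.1 hτ
    symm
    refine Finset.card_bij (fun x _ => insert x τ) ?_ ?_ ?_
    · intro x hx
      obtain ⟨-, hxτ, hD⟩ := Finset.mem_filter.1 hx
      simp only [Finset.bipartiteAbove, hR, Finset.mem_filter, Finset.mem_univ, true_and]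
      exact ⟨⟨hD, by rw [Finset.card_insert_of_notMem hxτ, hcard]⟩, Finset.subset_insert _ _⟩
    · intro x hx y hy h
      exact (Finset.insert_inj (Finset.mem_filter.1 hx).2.1).1 h
    · intro σ hσ
      simp only [Finset.bipartiteAbove, hR, Finset.mem_filter, Finset.mem_univ, true_and] at hσ
      obtain ⟨⟨h1, h2⟩, h3⟩ := hσ
      obtain ⟨x, hx, rfl⟩ := (Finset.covBy_iff_exists_insert.1
        (Finset.covBy_iff_card_sdiff_eq_one.2 ⟨h3, by
          rw [Finset.card_sdiff_of_subset h3]; omega⟩))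
      exact ⟨x, by simp [hx, h1], rfl⟩
  set τ₀ := ({i₀}ᶜ : Finset I).image e with hτ₀
  have hτ₀T : τ₀ ∈ T := by
    simp only [hT, Finset.mem_filter, Finset.mem_univ, true_and]
    constructor
    · rw [hτ₀, Finset.card_image_of_injective _ he, Finset.card_compl, Finset.card_singleton]
      have : 0 < Fintype.card I := Fintype.card_pos_iff.2 ⟨i₀⟩
      omega
    · rw [hτ₀, Finset.image_image, show c ∘ e = id from funext hce, Finset.image_id]
  have hleft : Odd (∑ τ ∈ T, (R.bipartiteAbove (fun τ σ => τ ⊆ σ) τ).card) := by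
    rw [← Finset.add_sum_erase _ _ hτ₀T, hdeg τ₀ hτ₀T,
      card_dominant_insert_slack u hu e hlow hhigh he i₀]
    refine Even.one_add (Finset.even_sum _ fun τ hτ => ?_)
    obtain ⟨hne, hτT⟩ := Finset.mem_erase.1 hτ
    rw [hdeg τ hτT]
    obtain ⟨-, hcard, hcol⟩ := Finset.mem_filter.1 hτT
    obtain ⟨t, ht, htr⟩ : ∃ t ∈ τ, t ∉ Set.range e := by
      by_contra! hall
      apply hne
      ext x
      rw [hτ₀]
      simp only [Finset.mem_image, Finset.mem_compl, Finset.mem_singleton]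
      constructor
      · intro hx
        obtain ⟨k, rfl⟩ := hall x hx
        refine ⟨k, ?_, rfl⟩
        have : c (e k) ∈ τ.image c := Finset.mem_image_of_mem _ hx
        rw [hcol, hce] at this
        simpa using this
      · rintro ⟨k, hk, rfl⟩
        have : k ∈ τ.image c := by rw [hcol]; simpa using hk
        obtain ⟨y, hy, hyk⟩ := Finset.mem_image.1 this
        obtain ⟨l, rfl⟩ := hall y hy
        rw [hce] at hyk
        rwa [← hyk]
    exact even_card_dominant_insert u hu τ hcard ⟨t, ht⟩ fun k =>
      ⟨e k, fun l hl => ⟨t, ht, hhigh l k t htr hl.symm⟩⟩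
  rw [hcount] at hleft
  exact Nat.not_even_iff_odd.2 hleft hright

end Scarf

section Brouwer

variable {I : Type*} [Fintype I] [Nonempty I]

/-- Integer form of Scarf's lemma on the discrete simplex of points with coordinate sum `M`: if the
points are coloured by `I`, there is a cluster of points in which every colour `i` is attained
unless the `i`-th coordinate is small throughout. -/
lemma exists_cluster_discrete_simplex (M : ℕ) (c : (I → ℕ) → I) :
    ∃ σ : Finset (I → ℕ), σ.Nonempty ∧ (∀ x ∈ σ, ∑ i, x i = M) ∧
      (∀ x ∈ σ, ∀ y ∈ σ, ∀ i, x i ≤ y i + Fintype.card I) ∧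
      ∀ i, (∃ x ∈ σ, c x = i) ∨ ∀ x ∈ σ, x i ≤ Fintype.card I := by
  classical
  let P : Finset (I → ℕ) := Finset.piAntidiag Finset.univ M
  have hP : ∀ x, x ∈ P ↔ ∑ i, x i = M := by intro x; simp [P]
  let X := P ⊕ I
  let lev : I → X → ℕ := fun i => Sum.elim (fun x => x.1 i + 1) fun j => if j = i then 0 else M + 2
  let u : I → X → ℕ ×ₗ Fin (Fintype.card X) := fun i x => toLex (lev i x, Fintype.equivFin X x)
  have hu : ∀ i, Function.Injective (u i) := by
    intro i x y h
    exact (Fintype.equivFin X).injective (congrArg Prod.snd (toLex.injective h))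
  have hlt : ∀ i x y, lev i x < lev i y → u i x < u i y := fun i x y h =>
    Prod.Lex.toLex_lt_toLex.2 (Or.inl h)
  have hle : ∀ i x y, u i x ≤ u i y → lev i x ≤ lev i y := fun i x y h => by
    by_contra! hcon
    exact (hlt i y x hcon).not_ge h
  have hxM : ∀ x : P, ∀ i, x.1 i ≤ M := fun x i => by
    rw [← (hP x.1).1 x.2]
    exact Finset.single_le_sum (f := x.1) (fun _ _ => Nat.zero_le _) (Finset.mem_univ i)
  obtain ⟨σ, hD, -, hcol⟩ := exists_dominant_image_eq_univ u hu (Sum.inr : I → X)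
    (by
      rintro i (x | j) hx
      · exact hlt _ _ _ (by simp [lev])
      · have : j ≠ i := fun h => hx (by rw [h])
        exact hlt _ _ _ (by simp [lev, this]))
    (by
      rintro i j (x | k) hx hji
      · refine hlt _ _ _ ?_
        have := hxM x i
        simp only [lev, Sum.elim_inl, Sum.elim_inr, if_neg hji]
        omega
      · exact absurd ⟨k, rfl⟩ hx)
    (Sum.elim (fun x => c x.1) id) (fun i => rfl)
  let σ' : Finset (I → ℕ) := P.filter fun x => ∃ h : x ∈ P, Sum.inl ⟨x, h⟩ ∈ σ
  have hσ' : ∀ x, x ∈ σ' ↔ ∃ h : x ∈ P, Sum.inl ⟨x, h⟩ ∈ σ := by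
    intro x
    simp only [σ', Finset.mem_filter, and_iff_right_iff_imp]
    exact fun h => h.1
  let C : Finset I := Finset.univ.filter fun i => Sum.inr i ∉ σ
  have hCcol : ∀ i ∈ C, ∃ x ∈ σ', c x = i := by
    intro i hi
    have : i ∈ σ.image (Sum.elim (fun x : P => c x.1) id) := by rw [hcol]; exact Finset.mem_univ i
    obtain ⟨x | j, hx, hxi⟩ := Finset.mem_image.1 this
    · exact ⟨x.1, (hσ' _).2 ⟨x.2, hx⟩, hxi⟩
    · simp only [Sum.elim_inr, id] at hxi
      subst hxi
      exact absurd hx (Finset.mem_filter.1 hi).2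
  have hdom : ∀ y ∈ P, ∃ i ∈ C, ∀ x ∈ σ', y i ≤ x i := by
    intro y hy
    obtain ⟨i, hi⟩ := hD (Sum.inl ⟨y, hy⟩)
    refine ⟨i, ?_, fun x hx => ?_⟩
    · refine Finset.mem_filter.2 ⟨Finset.mem_univ _, fun h => ?_⟩
      have := hle _ _ _ (hi _ h)
      simp [lev] at this
    · obtain ⟨hxP, hx⟩ := (hσ' x).1 hx
      have := hle _ _ _ (hi _ hx)
      simpa [lev] using this
  have hσne : σ'.Nonempty := by
    obtain ⟨j⟩ := ‹Nonempty I›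
    obtain ⟨i, hi, -⟩ := hdom (Pi.single j M) ((hP _).2 (by simp))
    obtain ⟨x, hx, -⟩ := hCcol i hi
    exact ⟨x, hx⟩
  have hsum : ∀ x ∈ σ', ∑ i, x i = M := fun x hx => (hP x).1 ((hσ' x).1 hx).1
  choose p hpσ hp using fun i => Finset.exists_min_image σ' (fun x => x i) hσne
  have hbig : M < ∑ i ∈ C, (p i i + 1) := by
    by_contra! hcon
    obtain ⟨j⟩ := ‹Nonempty I›
    let r := M - ∑ i ∈ C, (p i i + 1)
    obtain ⟨i, hi, hiy⟩ := hdom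
      (fun i => (if i ∈ C then p i i + 1 else 0) + Pi.single (M := fun _ => ℕ) j r i) (by
        rw [hP, Finset.sum_add_distrib, Finset.sum_ite_mem, Finset.univ_inter]
        simp only [Finset.sum_pi_single', Finset.mem_univ, if_true]
        omega)
    have := hiy _ (hpσ i)
    simp only [if_pos hi] at this
    omega
  have hbig' : M < ∑ i ∈ C, p i i + Fintype.card I := by
    rw [Finset.sum_add_distrib] at hbig
    have := Finset.card_le_univ C
    simp only [Finset.sum_const, smul_eq_mul, mul_one] at hbig
    omega
  have hinC : ∀ x ∈ σ', ∀ i ∈ C, x i ≤ p i i + Fintype.card I := by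
    intro x hx i hi
    have h1 : ∑ j ∈ C, x j ≤ M := by
      rw [← hsum x hx]
      exact Finset.sum_le_sum_of_subset (Finset.subset_univ C)
    rw [← Finset.add_sum_erase _ _ hi] at h1 hbig'
    have h2 : ∑ j ∈ C.erase i, p j j ≤ ∑ j ∈ C.erase i, x j :=
      Finset.sum_le_sum fun j _ => hp j x hx
    omega
  have hnotC : ∀ x ∈ σ', ∀ i ∉ C, x i ≤ Fintype.card I := by
    intro x hx i hi
    have h1 : ∑ j ∈ insert i C, x j ≤ M := by
      rw [← hsum x hx]
      exact Finset.sum_le_sum_of_subset (Finset.subset_univ _)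
    rw [Finset.sum_insert hi] at h1
    have h2 : ∑ j ∈ C, p j j ≤ ∑ j ∈ C, x j := Finset.sum_le_sum fun j _ => hp j x hx
    omega
  refine ⟨σ', hσne, hsum, fun x hx y hy i => ?_, fun i => ?_⟩
  · by_cases hi : i ∈ C
    · exact (hinC x hx i hi).trans (Nat.add_le_add_right (hp i y hy) _)
    · exact (hnotC x hx i hi).trans (Nat.le_add_left _ _)
  · by_cases hi : i ∈ C
    · exact Or.inl (hCcol i hi)
    · exact Or.inr fun x hx => hnotC x hx i hi

/-- Approximate form of Brouwer's theorem on the standard simplex. -/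
lemma exists_approx_le_stdSimplex (f : (I → ℝ) → I → ℝ)
    (hf : MapsTo f (stdSimplex ℝ I) (stdSimplex ℝ I)) (M : ℕ) (hM : 0 < M) :
    ∃ x₀ ∈ stdSimplex ℝ I, ∀ i, ∃ x ∈ stdSimplex ℝ I,
      dist x x₀ ≤ Fintype.card I / M ∧ x i ≤ f x i + Fintype.card I / M := by
  have hM' : (0 : ℝ) < M := Nat.cast_pos.2 hM
  let s : (I → ℕ) → I → ℝ := fun x i => x i / M
  have hs : ∀ x : I → ℕ, ∑ i, x i = M → s x ∈ stdSimplex ℝ I := by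
    intro x hx
    refine ⟨fun i => by positivity, ?_⟩
    simp only [s]
    rw [← Finset.sum_div, ← Nat.cast_sum, hx, div_self hM'.ne']
  have hcol : ∀ x : I → ℕ, ∃ i, ∑ i, x i = M → s x i ≤ f (s x) i := by
    intro x
    by_contra! hcon
    obtain ⟨j⟩ := ‹Nonempty I›
    have hx := (hcon j).1
    have hlt : ∑ i, f (s x) i < ∑ i, s x i :=
      Finset.sum_lt_sum_of_nonempty ⟨j, Finset.mem_univ j⟩ fun i _ => (hcon i).2
    rw [(hs x hx).2, (hf (hs x hx)).2] at hlt
    exact lt_irrefl _ hlt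
  choose c hc using hcol
  obtain ⟨σ, ⟨x₀, hx₀⟩, hsum, hclose, hcolor⟩ := exists_cluster_discrete_simplex M c
  refine ⟨s x₀, hs x₀ (hsum x₀ hx₀), fun i => ?_⟩
  rcases hcolor i with ⟨x, hx, rfl⟩ | hsmall
  · refine ⟨s x, hs x (hsum x hx), ?_, ?_⟩
    · refine (dist_pi_le_iff (by positivity)).2 fun j => ?_
      have h1 : (x j : ℝ) ≤ x₀ j + Fintype.card I := by exact_mod_cast hclose x hx x₀ hx₀ j
      have h2 : (x₀ j : ℝ) ≤ x j + Fintype.card I := by exact_mod_cast hclose x₀ hx₀ x hx j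
      rw [Real.dist_eq, ← sub_div, abs_div, abs_of_pos hM']
      gcongr
      exact abs_sub_le_iff.2 ⟨by linarith, by linarith⟩
    · have := hc x (hsum x hx)
      have : (0 : ℝ) ≤ Fintype.card I / M := by positivity
      linarith
  · refine ⟨s x₀, hs x₀ (hsum x₀ hx₀), by rw [dist_self]; positivity, ?_⟩
    have h1 : s x₀ i ≤ Fintype.card I / M := by
      simp only [s]
      gcongr
      exact_mod_cast hsmall x₀ hx₀
    have := (hf (hs x₀ (hsum x₀ hx₀))).1 i
    linarith

/-- **Brouwer's fixed point theorem** on the standard simplex. -/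
theorem exists_fixedPoint_stdSimplex (f : (I → ℝ) → I → ℝ)
    (hf : MapsTo f (stdSimplex ℝ I) (stdSimplex ℝ I)) (hfc : ContinuousOn f (stdSimplex ℝ I)) :
    ∃ x ∈ stdSimplex ℝ I, f x = x := by
  choose x₀ hx₀ y hy hdist hle using fun m : ℕ =>
    exists_approx_le_stdSimplex f hf (m + 1) m.succ_pos
  obtain ⟨x, hx, ψ, hψ, hlim⟩ := (isCompact_stdSimplex ℝ I).tendsto_subseq hx₀
  refine ⟨x, hx, ?_⟩
  have hzero : Tendsto (fun m => (Fintype.card I : ℝ) / ((ψ m + 1 : ℕ) : ℝ)) atTop (𝓝 0) :=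
    (tendsto_const_div_atTop_nhds_zero_nat _).comp
      ((tendsto_add_atTop_nat 1).comp hψ.tendsto_atTop)
  have hge : ∀ i, x i ≤ f x i := by
    intro i
    have hyx : Tendsto (fun m => y (ψ m) i) atTop (𝓝 x) := by
      rw [tendsto_iff_dist_tendsto_zero] at hlim ⊢
      refine squeeze_zero (fun _ => dist_nonneg)
        (fun m => (dist_triangle _ (x₀ (ψ m)) _).trans (add_le_add_left (hdist (ψ m) i) _)) ?_
      simpa using hzero.add hlim
    have hfy : Tendsto (fun m => f (y (ψ m) i)) atTop (𝓝 (f x)) :=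
      (hfc x hx).tendsto.comp
        (tendsto_nhdsWithin_iff.2 ⟨hyx, Eventually.of_forall fun m => hy _ i⟩)
    have h := ((tendsto_pi_nhds.1 hfy i).add hzero)
    rw [add_zero] at h
    exact le_of_tendsto_of_tendsto' (tendsto_pi_nhds.1 hyx i) h fun m => hle (ψ m) i
  have hsum : ∑ i, x i = ∑ i, f x i := by rw [hx.2, (hf hx).2]
  funext i
  exact ((Finset.sum_eq_sum_iff_of_le fun i _ => hge i).1 hsum i (Finset.mem_univ i)).symm

end Brouwer

section Kakutani

variable {E : Type*} [NormedAddCommGroup E] [NormedSpace ℝ E] {C : Set E} {H : E → Set E}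

/-- A multivalued self-map of a compact convex set has, for every `ε > 0`, a point in the convex
hull of the values at points `ε`-close to it. -/
lemma exists_mem_convexHull_biUnion_ball (hC : IsCompact C) (hCv : Convex ℝ C) (hCn : C.Nonempty)
    (hne : ∀ x ∈ C, (H x).Nonempty) (hsub : ∀ x ∈ C, H x ⊆ C) {ε : ℝ} (hε : 0 < ε) :
    ∃ x ∈ C, x ∈ convexHull ℝ (⋃ z ∈ C ∩ Metric.ball x ε, H z) := by
  obtain ⟨t, htC, htfin, hcover⟩ := hC.finite_cover_balls hε
  have hcover' : ∀ x ∈ C, ∃ i : t, dist x i < ε := by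
    intro x hx
    obtain ⟨z, hz, hxz⟩ := Set.mem_iUnion₂.1 (hcover hx)
    exact ⟨⟨z, hz⟩, hxz⟩
  have := htfin.fintype
  obtain ⟨x₁, hx₁⟩ := hCn
  have : Nonempty t := ⟨(hcover' x₁ hx₁).choose⟩
  choose y hy using fun i : t => hne i (htC i.2)
  let g : t → E → ℝ := fun i x => max 0 (ε - dist x i)
  have hg0 : ∀ i x, 0 ≤ g i x := fun i x => le_max_left _ _
  have hgpos : ∀ x ∈ C, 0 < ∑ i, g i x := by
    intro x hx
    obtain ⟨i, hi⟩ := hcover' x hx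
    exact Finset.sum_pos' (fun i _ => hg0 i x)
      ⟨i, Finset.mem_univ i, lt_max_of_lt_right (sub_pos.2 hi)⟩
  let q : (t → ℝ) → E := fun w => ∑ i, w i • y i
  have hqC : ∀ w ∈ stdSimplex ℝ t, q w ∈ C := fun w hw =>
    hCv.sum_mem (fun i _ => hw.1 i) hw.2 fun i _ => hsub i (htC i.2) (hy i)
  have hqc : Continuous q := by fun_prop
  let f : (t → ℝ) → t → ℝ := fun w i => g i (q w) / ∑ j, g j (q w)
  obtain ⟨w, hw, hfw⟩ := exists_fixedPoint_stdSimplex f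
    (fun w hw => ⟨fun i => div_nonneg (hg0 _ _) (hgpos _ (hqC w hw)).le, by
      simp only [f]
      rw [← Finset.sum_div, div_self (hgpos _ (hqC w hw)).ne']⟩)
    (continuousOn_pi.2 fun i => ContinuousOn.div (by fun_prop) (by fun_prop)
      fun w hw => (hgpos _ (hqC w hw)).ne')
  refine ⟨q w, hqC w hw, ?_⟩
  have hq : q w = ∑ i ∈ Finset.univ.filter (fun i => w i ≠ 0), w i • y i := by
    refine (Finset.sum_filter_of_ne (p := fun i => w i ≠ 0) fun i _ h hi => h ?_).symm
    rw [hi, zero_smul]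
  have hmem : ∀ i : t, w i ≠ 0 → (i : E) ∈ C ∩ Metric.ball (q w) ε := by
    intro i hi
    refine ⟨htC i.2, ?_⟩
    by_contra hcon
    apply hi
    rw [Metric.mem_ball, dist_comm, not_lt] at hcon
    rw [← hfw]
    simp only [f, g]
    rw [max_eq_left (sub_nonpos.2 hcon), zero_div]
  suffices h : ∑ i ∈ Finset.univ.filter (fun i => w i ≠ 0), w i • y i ∈
      convexHull ℝ (⋃ z ∈ C ∩ Metric.ball (q w) ε, H z) from hq ▸ h
  refine (convex_convexHull ℝ _).sum_mem (fun i _ => hw.1 i) ?_ fun i hi =>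
    subset_convexHull ℝ _ (Set.mem_biUnion (hmem i (Finset.mem_filter.1 hi).2) (hy i))
  rw [Finset.sum_filter_ne_zero]
  exact hw.2

/-- **Kakutani's fixed point theorem** in a normed space. -/
theorem exists_mem_of_isCompact_convex (hC : IsCompact C) (hCv : Convex ℝ C) (hCn : C.Nonempty)
    (hne : ∀ x ∈ C, (H x).Nonempty) (hHv : ∀ x ∈ C, Convex ℝ (H x)) (hsub : ∀ x ∈ C, H x ⊆ C)
    (hgraph : HasClosedGraphMV C H) : ∃ x ∈ C, x ∈ H x := by
  choose x hxC hx using fun m : ℕ =>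
    exists_mem_convexHull_biUnion_ball hC hCv hCn hne hsub (Nat.one_div_pos_of_nat (α := ℝ) (n := m))
  obtain ⟨a, ha, ψ, hψ, hlim⟩ := hC.tendsto_subseq hxC
  refine ⟨a, ha, ?_⟩
  have hclosed : IsClosed (H a) := by
    refine IsSeqClosed.isClosed fun y b hy hb => ?_
    exact hgraph (fun _ => a) y a b (fun _ => ha) ha tendsto_const_nhds hy hb
  have husc : ∀ δ > 0, ∃ η > 0, ∀ z ∈ C, dist z a < η → H z ⊆ Metric.thickening δ (H a) := by
    intro δ hδ
    by_contra! hcon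
    choose z hzC hza hz using fun m : ℕ => hcon _ (Nat.one_div_pos_of_nat (α := ℝ) (n := m))
    choose w hwz hw using fun m => Set.not_subset.1 (hz m)
    obtain ⟨b, -, ρ, hρ, hb⟩ := hC.tendsto_subseq fun m => hsub _ (hzC m) (hwz m)
    have hzlim : Tendsto z atTop (𝓝 a) := by
      rw [tendsto_iff_dist_tendsto_zero]
      exact squeeze_zero (fun _ => dist_nonneg) (fun m => (hza m).le)
        tendsto_one_div_add_atTop_nhds_zero_nat
    have hbH : b ∈ H a := hgraph (z ∘ ρ) (w ∘ ρ) a b (fun m => hzC _) ha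
      (hzlim.comp hρ.tendsto_atTop) (fun m => hwz _) hb
    obtain ⟨m, hm⟩ := (hb.eventually (Metric.isOpen_thickening.mem_nhds
      (Metric.self_subset_thickening hδ _ hbH))).exists
    exact hw _ hm
  rw [← hclosed.closure_eq, Metric.closure_eq_iInter_cthickening]
  refine Set.mem_iInter₂.2 fun δ hδ => ?_
  refine Metric.closure_thickening_subset_cthickening δ _ ?_
  obtain ⟨η, hη, hηH⟩ := husc δ hδ
  refine mem_closure_of_tendsto hlim ?_
  have h1 : ∀ᶠ m in atTop, dist ((x ∘ ψ) m) a < η / 2 :=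
    hlim.eventually (Metric.ball_mem_nhds a (half_pos hη))
  have h2 : ∀ᶠ m in atTop, 1 / ((ψ m : ℝ) + 1) < η / 2 :=
    (tendsto_one_div_add_atTop_nhds_zero_nat.comp hψ.tendsto_atTop).eventually
      (gt_mem_nhds (half_pos hη))
  filter_upwards [h1, h2] with m hm1 hm2
  refine convexHull_min (Set.iUnion₂_subset fun z hz => hηH z hz.1 ?_)
    ((hHv a ha).thickening δ) (hx (ψ m))
  have := Metric.mem_ball.1 hz.2
  have := dist_triangle z (x (ψ m)) a
  simp only [Function.comp] at hm1
  linarith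

end Kakutani

section Condensing

/-- A multivalued self-map of `S` with closed graph has a fixed point as soon as the sets `V ⊆ S`
that satisfy `V = closure (convexHull (H(V) ∪ {x₀}))` are compact. -/
theorem exists_mem_of_forall_eq_closure_convexHull {E : Type*} [NormedAddCommGroup E]
    [NormedSpace ℝ E] {S : Set E} {H : E → Set E} {x₀ : E} (hScl : IsClosed S) (hScv : Convex ℝ S)
    (hx₀ : x₀ ∈ S) (hne : ∀ x ∈ S, (H x).Nonempty) (hHv : ∀ x ∈ S, Convex ℝ (H x))
    (hsub : ∀ x ∈ S, H x ⊆ S) (hgraph : HasClosedGraphMV S H)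
    (hcompact : ∀ V ⊆ S, V = closure (convexHull ℝ (insert x₀ (⋃ x ∈ V, H x))) → IsCompact V) :
    ∃ x ∈ S, x ∈ H x := by
  let 𝒞 : Set (Set E) := {V | V ⊆ S ∧ IsClosed V ∧ Convex ℝ V ∧ x₀ ∈ V ∧ ∀ x ∈ V, H x ⊆ V}
  let C := ⋂₀ 𝒞
  have hS𝒞 : S ∈ 𝒞 := ⟨Subset.rfl, hScl, hScv, hx₀, hsub⟩
  have hCS : C ⊆ S := sInter_subset_of_mem hS𝒞
  have hCcl : IsClosed C := isClosed_sInter fun V hV => hV.2.1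
  have hCcv : Convex ℝ C := convex_sInter fun V hV => hV.2.2.1
  have hx₀C : x₀ ∈ C := mem_sInter.2 fun V hV => hV.2.2.2.1
  have hCH : ∀ x ∈ C, H x ⊆ C := fun x hx =>
    subset_sInter fun V hV => hV.2.2.2.2 x (mem_sInter.1 hx V hV)
  have hle : closure (convexHull ℝ (insert x₀ (⋃ x ∈ C, H x))) ⊆ C :=
    closure_minimal (convexHull_min (insert_subset hx₀C (iUnion₂_subset hCH)) hCcv) hCcl
  have hsubset : insert x₀ (⋃ x ∈ C, H x) ⊆ closure (convexHull ℝ (insert x₀ (⋃ x ∈ C, H x))) :=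
    (subset_convexHull ℝ _).trans subset_closure
  have hge : C ⊆ closure (convexHull ℝ (insert x₀ (⋃ x ∈ C, H x))) :=
    sInter_subset_of_mem ⟨hle.trans hCS, isClosed_closure, (convex_convexHull ℝ _).closure,
      hsubset (mem_insert _ _), fun x hx =>
        (subset_biUnion_of_mem (u := H) (hle hx)).trans ((subset_insert _ _).trans hsubset)⟩
  obtain ⟨x, hx, hxH⟩ := exists_mem_of_isCompact_convex (hcompact C hCS (hge.antisymm hle)) hCcv
    ⟨x₀, hx₀C⟩ (fun x hx => hne x (hCS hx)) (fun x hx => hHv x (hCS hx)) hCH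
    (fun x y a b hx ha => hgraph x y a b (fun m => hCS (hx m)) (hCS ha))
  exact ⟨x, hCS hx, hxH⟩

/-- The sum of two multivalued maps with closed graphs, one of them with values in a compact set,
has a closed graph. -/
lemma HasClosedGraphMV.add {E : Type*} [NormedAddCommGroup E] {S K : Set E} {F G : E → Set E}
    (hF : HasClosedGraphMV S F) (hG : HasClosedGraphMV S G) (hK : IsCompact K)
    (hGK : ∀ x ∈ S, G x ⊆ K) : HasClosedGraphMV S fun x => F x + G x := by
  intro x y a b hx ha hxa hy hyb
  choose v hv w hw hvw using fun m => Set.mem_add.1 (hy m)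
  obtain ⟨k, -, ψ, hψ, hk⟩ := hK.tendsto_subseq fun m => hGK _ (hx m) (hw m)
  have hxψ : Tendsto (x ∘ ψ) atTop (𝓝 a) := hxa.comp hψ.tendsto_atTop
  have hvψ : Tendsto (v ∘ ψ) atTop (𝓝 (b - k)) := by
    have : v ∘ ψ = y ∘ ψ - w ∘ ψ := by
      funext m
      simp [← hvw]
    rw [this]
    exact (hyb.comp hψ.tendsto_atTop).sub hk
  exact Set.mem_add.2 ⟨b - k, hF _ _ a _ (fun m => hx _) ha hxψ (fun m => hv _) hvψ, k,
    hG _ _ a _ (fun m => hx _) ha hxψ (fun m => hw _) hk, sub_add_cancel b k⟩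

lemma eq_zero_of_le_of_tendsto_iterate {ι : Type*} {φ : (ι → ℝ≥0) → ι → ℝ≥0} (hφ : Monotone φ)
    {t : ι → ℝ≥0} (hlim : Tendsto (fun m => φ^[m] t) atTop (𝓝 0)) (ht : t ≤ φ t) : t = 0 := by
  refine le_antisymm (ge_of_tendsto' hlim fun m => ?_) bot_le
  simpa using hφ.monotone_iterate_of_le_map ht (Nat.zero_le m)

/-- A **Krasnoselskii-type fixed point theorem** in a normed space, for the sum of a multivalued
`φ`-contraction of measure of noncompactness and a compact multivalued map. -/
theorem exists_mem_add_of_measure_contraction {E ι : Type*} [NormedAddCommGroup E]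
    [NormedSpace ℝ E] (S : Set E) (hS : S.Nonempty) (hScl : IsClosed S) (hScv : Convex ℝ S)
    (μ : Set E → ι → ℝ≥0∞)
    (hμ_hull : ∀ V : Set E, V.Nonempty → μ (closure (convexHull ℝ V)) = μ V)
    (hμ_mono : ∀ V₁ V₂ : Set E, V₁ ⊆ V₂ → ∀ i, μ V₁ i ≤ μ V₂ i)
    (hμ_real : ∀ V : Set E, IsBounded V → ∀ i, μ V i ≠ ⊤)
    (hμ_reg : ∀ V : Set E, (∀ i, μ V i = 0) ↔ IsCompact (closure V))
    (hμ_add : ∀ V₁ V₂ : Set E, V₁.Nonempty → V₂.Nonempty →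
      ∀ i, μ (V₁ + V₂) i ≤ μ V₁ i + μ V₂ i)
    (F G : E → Set E)
    (hFval : ∀ x ∈ S, (F x).Nonempty ∧ Convex ℝ (F x))
    (hGval : ∀ x ∈ S, (G x).Nonempty ∧ Convex ℝ (G x))
    (hFgraph : HasClosedGraphMV S F) (hGgraph : HasClosedGraphMV S G)
    (φ : (ι → ℝ≥0) → ι → ℝ≥0) (hφ_mono : Monotone φ)
    (hφ_iter : ∀ t, Tendsto (fun m => φ^[m] t) atTop (𝓝 0))
    (hcontr : ∀ V : Set E, V ⊆ S → IsBounded V →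
      ∀ i, μ (⋃ x ∈ V, F x) i ≤ (φ (fun j => (μ V j).toNNReal) i : ℝ≥0∞))
    (hGS : IsCompact (closure (⋃ x ∈ S, G x)))
    (hsum_sub : ∀ x ∈ S, F x + G x ⊆ S)
    (hsum_bd : IsBounded (⋃ x ∈ S, (F x + G x))) :
    ∃ x ∈ S, x ∈ F x + G x := by
  obtain ⟨x₀, hx₀⟩ := hS
  obtain ⟨a, ha⟩ := (hFval x₀ hx₀).1
  set K := closure (⋃ x ∈ S, G x) with hK
  have hGK : ∀ x ∈ S, G x ⊆ K := fun x hx =>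
    (subset_biUnion_of_mem (u := G) hx).trans subset_closure
  refine exists_mem_of_forall_eq_closure_convexHull hScl hScv hx₀
    (fun x hx => (hFval x hx).1.add (hGval x hx).1) (fun x hx => (hFval x hx).2.add (hGval x hx).2)
    hsum_sub (hFgraph.add hGgraph hGS hGK) fun V hVS hV => ?_
  set W := insert x₀ (⋃ x ∈ V, (F x + G x)) with hW
  have hWV : W ⊆ V := by
    conv_rhs => rw [hV]
    exact (subset_convexHull ℝ _).trans subset_closure
  have hx₀V : x₀ ∈ V := hWV (mem_insert _ _)
  have hWbd : IsBounded W :=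
    (hsum_bd.subset (biUnion_subset_biUnion_left hVS)).insert x₀
  have hVbd : IsBounded V := by
    rw [hV]
    exact ((isBounded_convexHull).2 hWbd).closure
  have hK' : IsCompact (insert (x₀ - a) K) := hGS.insert _
  have hμK : ∀ i, μ (insert (x₀ - a) K) i = 0 :=
    (hμ_reg _).2 (by rwa [hK'.isClosed.closure_eq])
  have haF : a ∈ ⋃ x ∈ V, F x := mem_biUnion hx₀V ha
  have hWsub : W ⊆ (⋃ x ∈ V, F x) + insert (x₀ - a) K := by
    refine insert_subset (Set.mem_add.2 ⟨a, haF, _, mem_insert _ _, add_sub_cancel a x₀⟩) ?_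
    exact iUnion₂_subset fun x hx => add_subset_add (subset_biUnion_of_mem (u := F) hx)
      ((hGK x (hVS hx)).trans (subset_insert _ _))
  have hμV : ∀ i, μ V i ≤ (φ (fun j => (μ V j).toNNReal) i : ℝ≥0∞) := fun i =>
    calc μ V i = μ W i := by conv_lhs => rw [hV, hμ_hull W (insert_nonempty _ _)]
      _ ≤ μ ((⋃ x ∈ V, F x) + insert (x₀ - a) K) i := hμ_mono _ _ hWsub i
      _ ≤ μ (⋃ x ∈ V, F x) i + μ (insert (x₀ - a) K) i :=
        hμ_add _ _ ⟨a, haF⟩ (insert_nonempty _ _) i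
      _ ≤ _ := by rw [hμK, add_zero]; exact hcontr V hVS hVbd i
  have hzero : (fun j => (μ V j).toNNReal) = 0 :=
    eq_zero_of_le_of_tendsto_iterate hφ_mono (hφ_iter _) fun i =>
      ENNReal.toNNReal_mono ENNReal.coe_ne_top (hμV i)
  have hVc := (hμ_reg V).1 fun i =>
    ((ENNReal.toNNReal_eq_zero_iff _).1 (congrFun hzero i)).resolve_right (hμ_real V hVbd i)
  have hVcl : IsClosed V := by rw [hV]; exact isClosed_closure
  rwa [hVcl.closure_eq] at hVc

end Condensing

/-- Krasnoselskii-type theorem for the sum of two multivalued maps `F`, `G`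
with closed graphs on a nonempty closed convex `S` in a generalized Banach space, where
`μ` is a monotone, regular, real, lower-additive generalized measure of noncompactness,
`μ(F(V)) ≤ φ(μ(V))` for bounded `V ⊆ S`, `G(S)` is relatively compact, `F x + G x ⊆ S`
for `x ∈ S`, and `⋃_{x∈S} (F x + G x)` is bounded.  Then `x ∈ F x + G x` for some `x ∈ S`. -/
theorem stmt_6
    {E : Type*} [AddCommGroup E] [Module ℝ E] [MetricSpace E] [CompleteSpace E]
    {n : ℕ} (hn : 1 ≤ n) (N : Fin n → E → ℝ)
    (hN_nonneg : ∀ i x, 0 ≤ N i x)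
    (hN_triangle : ∀ i (x y : E), N i (x + y) ≤ N i x + N i y)
    (hN_smul : ∀ i (a : ℝ) (x : E), N i (a • x) = |a| * N i x)
    (hN_zero : ∀ i (x : E), N i x = 0 → x = 0)
    (hdist : ∀ x y : E, dist x y = ⨆ i, N i (x - y))
    (S : Set E) (hS : S.Nonempty) (hScl : IsClosed S) (hScv : Convex ℝ S)
    (μ : Set E → Fin n → ℝ≥0∞)
    (hμ_hull : ∀ V : Set E, V.Nonempty → μ (closure (convexHull ℝ V)) = μ V)
    (hμ_mono : ∀ V₁ V₂ : Set E, V₁ ⊆ V₂ → ∀ i, μ V₁ i ≤ μ V₂ i)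
    (hμ_real : ∀ V : Set E, IsBounded V → ∀ i, μ V i ≠ ⊤)
    (hμ_reg : ∀ V : Set E, (∀ i, μ V i = 0) ↔ IsCompact (closure V))
    (hμ_add : ∀ V₁ V₂ : Set E, V₁.Nonempty → V₂.Nonempty →
      ∀ i, μ (V₁ + V₂) i ≤ μ V₁ i + μ V₂ i)
    (F G : E → Set E)
    (hFval : ∀ x ∈ S, (F x).Nonempty ∧ IsClosed (F x) ∧ Convex ℝ (F x))
    (hGval : ∀ x ∈ S, (G x).Nonempty ∧ IsClosed (G x) ∧ Convex ℝ (G x))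
    (hFgraph : HasClosedGraphMV S F)
    (hGgraph : HasClosedGraphMV S G)
    (φ : (Fin n → ℝ≥0) → (Fin n → ℝ≥0))
    (hφ_cont : Continuous φ) (hφ_mono : Monotone φ)
    (hφ_iter : ∀ t : Fin n → ℝ≥0, Tendsto (fun m => φ^[m] t) atTop (nhds 0))
    (hcontr : ∀ V : Set E, V ⊆ S → IsBounded V →
      ∀ i, μ (⋃ x ∈ V, F x) i ≤ (φ (fun j => (μ V j).toNNReal) i : ℝ≥0∞))
    (hGS : IsCompact (closure (⋃ x ∈ S, G x)))
    (hsum_sub : ∀ x ∈ S, F x + G x ⊆ S)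
    (hsum_bd : IsBounded (⋃ x ∈ S, (F x + G x))) :
    ∃ x ∈ S, x ∈ F x + G x := by
  have : Nonempty (Fin n) := ⟨⟨0, hn⟩⟩
  have hbdd : ∀ x : E, BddAbove (range fun i => N i x) := fun x => (finite_range _).bddAbove
  let : NormedAddCommGroup E :=
    { ‹AddCommGroup E›, ‹MetricSpace E› with
      norm := fun x => ⨆ i, N i x
      dist_eq := fun x y => by
        rw [dist_comm, hdist, neg_add_eq_sub] }
  let : NormedSpace ℝ E :=
    { ‹Module ℝ E› with
      norm_smul_le := fun a x => by
        change (⨆ i, N i (a • x)) ≤ |a| * ⨆ i, N i x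
        exact ciSup_le fun i => (hN_smul i a x).trans_le
          (mul_le_mul_of_nonneg_left (le_ciSup (hbdd x) i) (abs_nonneg a)) }
  exact exists_mem_add_of_measure_contraction S hS hScl hScv μ hμ_hull hμ_mono hμ_real hμ_reg hμ_add
    F G (fun x hx => ⟨(hFval x hx).1, (hFval x hx).2.2⟩)
    (fun x hx => ⟨(hGval x hx).1, (hGval x hx).2.2⟩) hFgraph hGgraph φ hφ_mono hφ_iter hcontr hGS
    hsum_sub hsum_bd
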